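/- Ada-LISTA convergence guarantee (Theorem 1). Suppose y = D x* + e for some x* ∈ ℝ^m and e ∈ ℝ^n, and assume a_iᵀ d_i = 1 for every i ∈ {1,…,m}. Let μ̃ = max_{i≠j} |a_iᵀ d_j| and s = ‖x*‖₀, and assume 2 μ̃ s < 1. Let γ ∈ ℝ satisfy 1 < γ and 2 γ μ̃ s < 1, let θ_max ≥ ‖Aᵀ y‖∞, and run the Ada-LISTA iteration with thresholds θ_k = θ_max γ^{−k}. Then for every K ≥ 0 such that ‖Aᵀ e‖∞ ≤ θ_max γ^{−K} (1 − 2 γ μ̃ s), the K-th iterate satisfies Supp(x_K) ⊆ Supp(x*) and ‖x_K − x*‖∞ ≤ 2 θ_max γ^{−K}. -/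

import Mathlib

open Matrix

/-- Entrywise soft-thresholding operator with threshold `θ`. -/
noncomputable def softThresh {m : ℕ} (θ : ℝ) (v : Fin m → ℝ) : Fin m → ℝ :=
  fun i => Real.sign (v i) * max (|v i| - θ) 0

/-- The Ada-LISTA iteration (single weight matrix): `x₀ = 0`,
`x_{k+1} = S_{θ_{k+1}}(x_k + Dᵀ Wᵀ (y − D x_k))`. -/
noncomputable def adaIter {n m : ℕ} (D : Matrix (Fin n) (Fin m) ℝ)
    (W : Matrix (Fin n) (Fin n) ℝ) (y : Fin n → ℝ) (θ : ℕ → ℝ) : ℕ → Fin m → ℝ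
  | 0 => 0
  | k + 1 =>
      softThresh (θ (k + 1))
        (adaIter D W y θ k +
          (Dᵀ * Wᵀ).mulVec (y - D.mulVec (adaIter D W y θ k)))

theorem softThresh_apply_eq_zero {m : ℕ} {θ : ℝ} {v : Fin m → ℝ} {i : Fin m}
    (h : |v i| ≤ θ) : softThresh θ v i = 0 := by
  simp [softThresh, max_eq_right (sub_nonpos.mpr h)]

theorem abs_softThresh_sub_le {m : ℕ} {θ : ℝ} (hθ : 0 ≤ θ) (v : Fin m → ℝ) (i : Fin m) :
    |softThresh θ v i - v i| ≤ θ := by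
  rcases le_total |v i| θ with h | h
  · simpa [softThresh_apply_eq_zero h] using h
  · rw [softThresh, max_eq_left (sub_nonneg.mpr h)]
    rcases lt_trichotomy (v i) 0 with hv | hv | hv
    · rw [Real.sign_of_neg hv, abs_of_neg hv, abs_le]
      constructor <;> linarith
    · simpa [hv] using hθ
    · rw [Real.sign_of_pos hv, abs_of_pos hv, abs_le]
      constructor <;> linarith

/-- A matrix with unit diagonal and off-diagonal entries bounded by `μ` moves a vector supported
on `S` by at most `μ * #S * B` in each coordinate, if `B` bounds the entries of the vector. -/
theorem abs_mulVec_sub_le {ι : Type*} [Fintype ι] {G : Matrix ι ι ℝ} {μ B : ℝ}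
    (hdiag : ∀ i, G i i = 1) (hμ : 0 ≤ μ) (hoff : ∀ i j, i ≠ j → |G i j| ≤ μ)
    {u : ι → ℝ} {S : Finset ι} (hS : ∀ j ∉ S, u j = 0) (hB : ‖u‖ ≤ B) (i : ι) :
    |(G *ᵥ u) i - u i| ≤ μ * S.card * B := by
  classical
  have hB0 : 0 ≤ B := (norm_nonneg u).trans hB
  have hsum : (G *ᵥ u) i - u i = ∑ j ∈ S, (G - 1) i j * u j := by
    rw [Finset.sum_subset (Finset.subset_univ S) fun j _ hj => by rw [hS j hj, mul_zero]]
    change _ = ((G - 1) *ᵥ u) i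
    rw [Matrix.sub_mulVec, Matrix.one_mulVec, Pi.sub_apply]
  have hterm : ∀ j ∈ S, |(G - 1) i j * u j| ≤ μ * B := by
    intro j _
    rw [abs_mul]
    refine mul_le_mul ?_ ((norm_le_pi_norm u j).trans hB) (abs_nonneg _) hμ
    by_cases hij : i = j
    · subst hij
      simpa [hdiag] using hμ
    · simpa [hij] using hoff i j hij
  calc |(G *ᵥ u) i - u i| ≤ ∑ j ∈ S, |(G - 1) i j * u j| := by
        rw [hsum]
        exact Finset.abs_sum_le_sum_abs _ _
    _ ≤ S.card • (μ * B) := Finset.sum_le_card_nsmul _ _ _ hterm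
    _ = μ * S.card * B := by rw [nsmul_eq_mul]; ring

/-- Theorem 1 (Ada-LISTA convergence guarantee). -/
theorem adaLISTA_convergence_guarantee {n m : ℕ}
    (D : Matrix (Fin n) (Fin m) ℝ) (W : Matrix (Fin n) (Fin n) ℝ)
    (xstar : Fin m → ℝ) (e : Fin n → ℝ) (y : Fin n → ℝ)
    (hy : y = D.mulVec xstar + e)
    (hdiag : ∀ i, (Dᵀ * Wᵀ * D) i i = 1)
    (μ : ℝ)
    (hμ : μ = ⨆ p : {p : Fin m × Fin m // p.1 ≠ p.2}, |(Dᵀ * Wᵀ * D) p.1.1 p.1.2|)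
    (s : ℕ) (hs : s = (Finset.univ.filter fun i => xstar i ≠ 0).card)
    (hμs : 2 * μ * (s : ℝ) < 1)
    (γ : ℝ) (hγ : 1 < γ) (hγμs : 2 * γ * μ * (s : ℝ) < 1)
    (θmax : ℝ) (hθmax : ‖(W * D)ᵀ.mulVec y‖ ≤ θmax)
    (K : ℕ)
    (hK : ‖(W * D)ᵀ.mulVec e‖ ≤ θmax / γ ^ K * (1 - 2 * γ * μ * (s : ℝ))) :
    Function.support (adaIter D W y (fun k => θmax / γ ^ k) K) ⊆ Function.support xstar ∧
      ‖adaIter D W y (fun k => θmax / γ ^ k) K - xstar‖ ≤ 2 * θmax / γ ^ K := by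
  have hμ0 : 0 ≤ μ := hμ ▸ Real.iSup_nonneg fun _ => abs_nonneg _
  have hoff : ∀ i j, i ≠ j → |(Dᵀ * Wᵀ * D) i j| ≤ μ := fun i j hij => hμ ▸
    le_ciSup (f := fun p : {p : Fin m × Fin m // p.1 ≠ p.2} =>
      |(Dᵀ * Wᵀ * D) p.1.1 p.1.2|) (Set.finite_range _).bddAbove ⟨(i, j), hij⟩
  rw [Matrix.transpose_mul] at hθmax hK
  have hθ0 : 0 ≤ θmax := (norm_nonneg _).trans hθmax
  have hγ0 : 0 < γ := zero_lt_one.trans hγ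
  have hμs0 : 0 ≤ μ * s := by positivity
  have hnoise : ∀ k ≤ K, ∀ i,
      |((Dᵀ * Wᵀ) *ᵥ e) i| ≤ θmax / γ ^ k * (1 - 2 * γ * μ * s) := by
    intro k hk i
    refine ((norm_le_pi_norm _ i).trans hK).trans ?_
    refine mul_le_mul_of_nonneg_right ?_ (by linarith)
    exact div_le_div_of_nonneg_left hθ0 (by positivity) (pow_le_pow_right₀ hγ.le hk)
  have hstep : ∀ {u : Fin m → ℝ} {B : ℝ}, Function.support u ⊆ Function.support xstar →
      ‖u‖ ≤ B → ∀ i, |((Dᵀ * Wᵀ * D) *ᵥ u) i - u i| ≤ μ * s * B := by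
    intro u B hu hB i
    rw [hs]
    refine abs_mulVec_sub_le hdiag hμ0 hoff (fun j hj => ?_) hB i
    by_contra h
    exact hj (by simpa using hu h)
  have hstar : ‖xstar‖ ≤ 2 * θmax := by
    have hbound : ‖xstar‖ ≤ θmax + θmax * (1 - 2 * γ * μ * s) + μ * s * ‖xstar‖ := by
      refine (pi_norm_le_iff_of_nonneg ?_).mpr fun i => ?_
      · have : 0 ≤ 1 - 2 * γ * μ * s := by linarith
        positivity
      have h1 := hstep subset_rfl le_rfl i
      have h2 := hnoise 0 (Nat.zero_le K) i
      have h3 : |((Dᵀ * Wᵀ) *ᵥ y) i| ≤ θmax := (norm_le_pi_norm _ i).trans hθmax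
      rw [hy, Matrix.mulVec_add, Matrix.mulVec_mulVec, Pi.add_apply] at h3
      rw [pow_zero, div_one] at h2
      rw [Real.norm_eq_abs]
      rw [abs_le] at *
      constructor <;> linarith
    have hγμ : μ * s ≤ γ * (μ * s) := le_mul_of_one_le_left hμs0 hγ.le
    nlinarith [mul_le_mul_of_nonneg_left hγμ hθ0]
  suffices h : ∀ k ≤ K,
      Function.support (adaIter D W y (fun k => θmax / γ ^ k) k) ⊆ Function.support xstar ∧
        ‖adaIter D W y (fun k => θmax / γ ^ k) k - xstar‖ ≤ 2 * θmax / γ ^ k from h K le_rfl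
  intro k
  induction k with
  | zero => exact fun _ => ⟨by simp [adaIter], by simpa [adaIter] using hstar⟩
  | succ k ih =>
    intro hk
    obtain ⟨hsupp, herr⟩ := ih (Nat.le_of_succ_le hk)
    rw [adaIter]
    set x := adaIter D W y (fun k => θmax / γ ^ k) k
    set v := x + (Dᵀ * Wᵀ) *ᵥ (y - D *ᵥ x) with hv
    have hθk : 0 ≤ θmax / γ ^ (k + 1) := by positivity
    have hvx : ∀ i, |v i - xstar i| ≤ θmax / γ ^ (k + 1) := by
      intro i
      have hu : Function.support (xstar - x) ⊆ Function.support xstar :=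
        (Function.support_sub _ _).trans (Set.union_subset subset_rfl hsupp)
      have h1 := hstep hu ((norm_sub_rev _ _).trans_le herr) i
      have h2 := hnoise (k + 1) hk i
      have hvi : v i - xstar i = (((Dᵀ * Wᵀ * D) *ᵥ (xstar - x)) i - (xstar - x) i) +
          ((Dᵀ * Wᵀ) *ᵥ e) i := by
        have hres : y - D *ᵥ x = D *ᵥ (xstar - x) + e := by
          rw [hy, Matrix.mulVec_sub]
          abel
        rw [hv, hres, Matrix.mulVec_add, Matrix.mulVec_mulVec]
        simp only [Pi.add_apply, Pi.sub_apply]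
        ring
      have hθs : 2 * θmax / γ ^ k = 2 * γ * (θmax / γ ^ (k + 1)) := by
        rw [pow_succ]
        field_simp
      rw [hθs] at h1
      rw [hvi]
      refine (abs_add_le _ _).trans ((add_le_add h1 h2).trans_eq ?_)
      ring
    refine ⟨fun i hi => ?_, (pi_norm_le_iff_of_nonneg (by positivity)).mpr fun i => ?_⟩
    · contrapose! hi
      have hxi : xstar i = 0 := by simpa using hi
      have := hvx i
      rw [hxi, sub_zero] at this
      simpa using softThresh_apply_eq_zero this
    · calc |softThresh (θmax / γ ^ (k + 1)) v i - xstar i|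
          ≤ |softThresh (θmax / γ ^ (k + 1)) v i - v i| + |v i - xstar i| := abs_sub_le _ _ _
        _ ≤ θmax / γ ^ (k + 1) + θmax / γ ^ (k + 1) :=
          add_le_add (abs_softThresh_sub_le hθk v i) (hvx i)
        _ = 2 * θmax / γ ^ (k + 1) := by ring
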